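/- arXiv:1308.2995 — 2 statements merged into one kernel-verified Lean document; each statement's English description precedes it below -/
import Mathlib

section
/- For every β ∈ I and every integer m > 0, the family indexed by r ∈ ℤ whose r-th member is a*(β,r)·a(β,m−r)·u_n when r ≤ 0 and a(β,m−r)·a*(β,r)·u_n when r > 0 has finite support in M_n, and its sum equals 0. (This is the statement [:a_β(z)a*_β(z):]_m · u_n = 0 for all m > 0.) -/
noncomputable section

/-- Generators of the infinite-dimensional Weyl algebra: `a γ r` and `as γ r`
(the latter playing the role of `a*(γ,r)`), for `γ ∈ I`, `r ∈ ℤ`. -/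
inductive WGen (I : Type) : Type
  | a : I → ℤ → WGen I
  | as : I → ℤ → WGen I

open FreeAlgebra in
/-- The defining relations of the infinite-dimensional Weyl algebra `𝒜`:
`a(γ,r)·a*(δ,s) − a*(δ,s)·a(γ,r) = (1 if γ = δ and r = −s, else 0)`, while the `a`'s
commute among themselves and the `a*`'s commute among themselves. -/
inductive WeylRel (I : Type) : FreeAlgebra ℂ (WGen I) → FreeAlgebra ℂ (WGen I) → Prop
  | a_as_eq (γ : I) (r : ℤ) :
      WeylRel I (ι ℂ (WGen.a γ r) * ι ℂ (WGen.as γ (-r)))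
        (ι ℂ (WGen.as γ (-r)) * ι ℂ (WGen.a γ r) + 1)
  | a_as_ne (γ δ : I) (r s : ℤ) (h : γ ≠ δ ∨ r ≠ -s) :
      WeylRel I (ι ℂ (WGen.a γ r) * ι ℂ (WGen.as δ s))
        (ι ℂ (WGen.as δ s) * ι ℂ (WGen.a γ r))
  | a_a (γ δ : I) (r s : ℤ) :
      WeylRel I (ι ℂ (WGen.a γ r) * ι ℂ (WGen.a δ s))
        (ι ℂ (WGen.a δ s) * ι ℂ (WGen.a γ r))
  | as_as (γ δ : I) (r s : ℤ) :
      WeylRel I (ι ℂ (WGen.as γ r) * ι ℂ (WGen.as δ s))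
        (ι ℂ (WGen.as δ s) * ι ℂ (WGen.as γ r))

/-- The infinite-dimensional Weyl algebra `𝒜`: the quotient of the free ℂ-algebra on
the generators `a(γ,r)`, `a*(γ,r)` by the two-sided ideal generated by the relations. -/
abbrev WeylAlg (I : Type) : Type := RingQuot (WeylRel I)

/-- The generator `a(γ,r)` of `𝒜`. -/
def wa {I : Type} (γ : I) (r : ℤ) : WeylAlg I :=
  RingQuot.mkAlgHom ℂ (WeylRel I) (FreeAlgebra.ι ℂ (WGen.a γ r))

/-- The generator `a*(γ,r)` of `𝒜`. -/
def was {I : Type} (γ : I) (r : ℤ) : WeylAlg I :=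
  RingQuot.mkAlgHom ℂ (WeylRel I) (FreeAlgebra.ι ℂ (WGen.as γ r))

/-- The left ideal of `𝒜` generated by the `a(γ,r)` with `r ≥ n` and the
`a*(γ,r)` with `r ≥ 1 − n`. -/
def fockIdeal (I : Type) (n : ℕ) : Submodule (WeylAlg I) (WeylAlg I) :=
  Submodule.span (WeylAlg I)
    ({x | ∃ γ : I, ∃ r : ℤ, (n : ℤ) ≤ r ∧ x = wa γ r} ∪
     {x | ∃ γ : I, ∃ r : ℤ, 1 - (n : ℤ) ≤ r ∧ x = was γ r})

/-- The Fock module `M_n = 𝒜 / 𝒜·(a(γ,r) : r ≥ n, a*(γ,r) : r ≥ 1−n)`,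
a left `𝒜`-module. -/
abbrev Fock (I : Type) (n : ℕ) : Type := WeylAlg I ⧸ fockIdeal I n

/-- The vacuum vector `u_n ∈ M_n`, the image of `1 ∈ 𝒜`. -/
def fockVac (I : Type) (n : ℕ) : Fock I n := Submodule.Quotient.mk 1


/-- `a(γ,r)` and `a*(δ,s)` commute unless `r = -s`. -/
theorem wa_mul_was_of_ne {I : Type} (γ δ : I) {r s : ℤ} (h : r ≠ -s) :
    wa γ r * was δ s = was δ s * wa γ r := by
  simpa only [wa, was, map_mul] using
    RingQuot.mkAlgHom_rel ℂ (WeylRel.a_as_ne γ δ r s (Or.inr h))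

theorem smul_fockVac_eq_zero {I : Type} {n : ℕ} {x : WeylAlg I} (h : x ∈ fockIdeal I n) :
    x • fockVac I n = 0 := by
  rw [fockVac, ← Submodule.Quotient.mk_smul, smul_eq_mul, mul_one]
  exact (Submodule.Quotient.mk_eq_zero _).2 h

theorem wa_smul_fockVac {I : Type} {n : ℕ} (γ : I) {r : ℤ} (h : (n : ℤ) ≤ r) :
    wa γ r • fockVac I n = 0 :=
  smul_fockVac_eq_zero (Submodule.subset_span (Or.inl ⟨γ, r, h, rfl⟩))

theorem was_smul_fockVac {I : Type} {n : ℕ} (γ : I) {r : ℤ} (h : 1 - (n : ℤ) ≤ r) :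
    was γ r • fockVac I n = 0 :=
  smul_fockVac_eq_zero (Submodule.subset_span (Or.inr ⟨γ, r, h, rfl⟩))

/-- In positive total degree each product `a*(γ,r)·a(γ,m−r)` kills the vacuum. -/
theorem was_mul_wa_smul_fockVac {I : Type} (n : ℕ) (γ : I) {m : ℤ} (hm : 0 < m) (r : ℤ) :
    (was γ r * wa γ (m - r)) • fockVac I n = 0 := by
  by_cases h : 1 - (n : ℤ) ≤ r
  · rw [← wa_mul_was_of_ne γ γ (by lia), mul_smul, was_smul_fockVac γ h, smul_zero]
  · rw [mul_smul, wa_smul_fockVac γ (by lia), smul_zero]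

/-!
STATEMENT 2: for every `β ∈ I` and integer `m > 0`, the family indexed by `r ∈ ℤ`
whose `r`-th member is `a*(β,r)·a(β,m−r)·u_n` for `r ≤ 0` and `a(β,m−r)·a*(β,r)·u_n`
for `r > 0` has finite support in `M_n` and sums to `0`;
i.e. `[:a_β(z)a*_β(z):]_m · u_n = 0` for all `m > 0`.
-/
theorem normally_ordered_positive_mode_on_vacuum
    (n : ℕ) (hn : 1 ≤ n) (I : Type) (β : I) (m : ℤ) (hm : 0 < m) :
    (Function.support (fun r : ℤ =>
        if r ≤ 0 then (was β r * wa β (m - r)) • fockVac I n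
        else (wa β (m - r) * was β r) • fockVac I n)).Finite ∧
    (∑ᶠ r : ℤ,
        (if r ≤ 0 then (was β r * wa β (m - r)) • fockVac I n
         else (wa β (m - r) * was β r) • fockVac I n)) = 0 := by
  have hterm (r : ℤ) :
      (if r ≤ 0 then (was β r * wa β (m - r)) • fockVac I n
        else (wa β (m - r) * was β r) • fockVac I n) = 0 := by
    rw [wa_mul_was_of_ne β β (by lia), ite_self, was_mul_wa_smul_fockVac n β hm]
  simp [hterm]

end
end

section
/- The vacuum vector v_n is nonzero in π(Λ); equivalently, the left ideal of U(H) generated by 𝟙 − 1 and the elements b(i,r) − Λ(i,r)·1 for i ∈ J and r ≥ 0 is a proper left ideal. (This nontriviality of the induced Heisenberg module underlies the assertion that the homomorphism from the generalized Verma module to the generalized Wakimoto module is nontrivial.) -/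
noncomputable section

/-- A symmetric complex-valued function on `J × J`. -/
structure SymForm (J : Type) where
  toFun : J → J → ℂ
  symm : ∀ i j, toFun i j = toFun j i

/-- The structure constant of the Heisenberg bracket:
`[b(i,r), b(j,s)] = −r·B(i,j)·𝟙` when `s = −r`, and `0` otherwise. -/
def heisCoef {J : Type} (B : SymForm J) (p q : J × ℤ) : ℂ :=
  if q.2 = -p.2 then (-(p.2 : ℂ)) * B.toFun p.1 q.1 else 0

lemma heisCoef_skew {J : Type} (B : SymForm J) (p q : J × ℤ) :
    heisCoef B p q = -heisCoef B q p := by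
  unfold heisCoef
  by_cases h : q.2 = -p.2
  · have h' : p.2 = -q.2 := by omega
    rw [if_pos h, if_pos h']
    have hc : ((q.2 : ℤ) : ℂ) = -((p.2 : ℤ) : ℂ) := by rw [h]; push_cast; ring
    rw [B.symm p.1 q.1]
    rw [show (-(q.2 : ℂ)) = (p.2 : ℂ) by rw [hc]; ring]
    ring
  · have h' : ¬ p.2 = -q.2 := by omega
    rw [if_neg h, if_neg h']
    ring

/-- The Heisenberg Lie algebra `H`: the ℂ-vector space with basis
`{b(i,r) : i ∈ J, r ∈ ℤ} ∪ {𝟙}`, realized as `((J × ℤ) →₀ ℂ) × ℂ`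
(first component: coordinates in the `b(i,r)`'s; second: coefficient of `𝟙`). -/
def Heis (J : Type) (_B : SymForm J) : Type := ((J × ℤ) →₀ ℂ) × ℂ

variable {J : Type} {B : SymForm J}

instance : AddCommGroup (Heis J B) := inferInstanceAs (AddCommGroup (((J × ℤ) →₀ ℂ) × ℂ))
instance : Module ℂ (Heis J B) := inferInstanceAs (Module ℂ (((J × ℤ) →₀ ℂ) × ℂ))

lemma heis_add_fst (x y : Heis J B) : (x + y).1 = x.1 + y.1 := rfl
lemma heis_add_snd (x y : Heis J B) : (x + y).2 = x.2 + y.2 := rfl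
lemma heis_smul_fst (t : ℂ) (x : Heis J B) : (t • x).1 = t • x.1 := rfl

/-- The bracket on `H`, determined by `[b(i,r), b(j,s)] = −r·B(i,j)·𝟙` if `r = −s`
and `0` otherwise, with `𝟙` central. -/
instance : Bracket (Heis J B) (Heis J B) :=
  ⟨fun x y => (0, x.1.sum fun p c => y.1.sum fun q d => c * d * heisCoef B p q)⟩

lemma heis_bracket_def (x y : Heis J B) :
    ⁅x, y⁆ = ((0 : (J × ℤ) →₀ ℂ),
      x.1.sum fun p c => y.1.sum fun q d => c * d * heisCoef B p q) := rfl

lemma heis_bracket_fst (x y : Heis J B) : (⁅x, y⁆ : Heis J B).1 = 0 := rfl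

lemma heis_bracket_snd (x y : Heis J B) :
    (⁅x, y⁆ : Heis J B).2 = x.1.sum fun p c => y.1.sum fun q d => c * d * heisCoef B p q := rfl

instance : LieRing (Heis J B) where
  add_lie x y z := by
    refine Prod.ext ?_ ?_
    · rw [heis_bracket_fst, heis_add_fst, heis_bracket_fst, heis_bracket_fst, add_zero]
    · rw [heis_bracket_snd, heis_add_snd, heis_bracket_snd, heis_bracket_snd, heis_add_fst]
      rw [Finsupp.sum_add_index']
      · intro p
        simp
      · intro p c c'
        rw [← Finsupp.sum_add]
        exact Finsupp.sum_congr fun q _ => by ring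
  lie_add x y z := by
    refine Prod.ext ?_ ?_
    · rw [heis_bracket_fst, heis_add_fst, heis_bracket_fst, heis_bracket_fst, add_zero]
    · rw [heis_bracket_snd, heis_add_snd, heis_bracket_snd, heis_bracket_snd, heis_add_fst]
      rw [← Finsupp.sum_add]
      refine Finsupp.sum_congr fun p _ => ?_
      rw [Finsupp.sum_add_index']
      · intro q
        simp
      · intro q d d'
        ring
  lie_self x := by
    refine Prod.ext rfl ?_
    rw [heis_bracket_snd]
    show (x.1.sum fun p c => x.1.sum fun q d => c * d * heisCoef B p q) = (0 : Heis J B).2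
    have h0 : ((0 : Heis J B)).2 = (0 : ℂ) := rfl
    rw [h0]
    have e1 : (x.1.sum fun p c => x.1.sum fun q d => c * d * heisCoef B p q)
        = x.1.sum fun p c => x.1.sum fun q d => c * d * -heisCoef B q p :=
      Finsupp.sum_congr fun p _ => Finsupp.sum_congr fun q _ => by
        rw [heisCoef_skew B p q]
    have e2 : (x.1.sum fun p c => x.1.sum fun q d => c * d * -heisCoef B q p)
        = -(x.1.sum fun p c => x.1.sum fun q d => c * d * heisCoef B q p) := by
      rw [← Finsupp.sum_neg]
      exact Finsupp.sum_congr fun p _ => by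
        rw [← Finsupp.sum_neg]
        exact Finsupp.sum_congr fun q _ => by ring
    have e3 : (x.1.sum fun p c => x.1.sum fun q d => c * d * heisCoef B q p)
        = x.1.sum fun p c => x.1.sum fun q d => c * d * heisCoef B p q := by
      rw [Finsupp.sum_comm]
      exact Finsupp.sum_congr fun q _ => Finsupp.sum_congr fun p _ => by ring
    have h1 := e1.trans e2
    rw [e3] at h1
    have h2 : (2 : ℂ) * (x.1.sum fun p c => x.1.sum fun q d => c * d * heisCoef B p q) = 0 := by
      linear_combination h1
    rcases mul_eq_zero.mp h2 with h | h
    · exact absurd h two_ne_zero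
    · exact h
  leibniz_lie x y z := by
    refine Prod.ext ?_ ?_
    · simp [heis_bracket_fst, heis_add_fst]
    · simp [heis_bracket_snd, heis_bracket_fst, heis_add_snd, Finsupp.sum_zero_index]

instance : LieAlgebra ℂ (Heis J B) where
  lie_smul t x y := by
    refine Prod.ext ?_ ?_
    · rw [heis_bracket_fst, heis_smul_fst, heis_bracket_fst, smul_zero]
    · have hsnd : ((t • ⁅x, y⁆ : Heis J B)).2 = t * (⁅x, y⁆ : Heis J B).2 := rfl
      rw [heis_bracket_snd, hsnd, heis_bracket_snd, heis_smul_fst]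
      have step1 : (x.1.sum fun p c => (t • y.1).sum fun q d => c * d * heisCoef B p q)
          = x.1.sum fun p c => y.1.sum fun q d => t * (c * d * heisCoef B p q) := by
        refine Finsupp.sum_congr fun p _ => ?_
        rw [Finsupp.sum_smul_index (fun q => by ring)]
        exact Finsupp.sum_congr fun q _ => by ring
      rw [step1]
      have step2 : ∀ (f : (J × ℤ) →₀ ℂ) (g : J × ℤ → ℂ → ℂ),
          (f.sum fun a b => t * g a b) = t * f.sum g := by
        intro f g
        rw [Finsupp.sum, Finsupp.sum, Finset.mul_sum]
      calc (x.1.sum fun p c => y.1.sum fun q d => t * (c * d * heisCoef B p q))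
          = x.1.sum fun p c => t * (y.1.sum fun q d => c * d * heisCoef B p q) :=
            Finsupp.sum_congr fun p _ => step2 y.1 _
        _ = t * x.1.sum fun p c => y.1.sum fun q d => c * d * heisCoef B p q := step2 x.1 _

/-- The basis vector `b(i,r)` of the Heisenberg Lie algebra. -/
def heisB (B : SymForm J) (i : J) (r : ℤ) : Heis J B := (Finsupp.single (i, r) 1, 0)

/-- The central basis vector `𝟙` of the Heisenberg Lie algebra. -/
def heisOne (B : SymForm J) : Heis J B := (0, 1)

/-- The left ideal of `U(H)` generated by `𝟙 − 1` and the elements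
`b(i,r) − Λ(i,r)·1` for `i ∈ J` and integers `r ≥ 0`. -/
def heisIdeal (B : SymForm J) (Λ : J → ℤ → ℂ) :
    Submodule (UniversalEnvelopingAlgebra ℂ (Heis J B))
      (UniversalEnvelopingAlgebra ℂ (Heis J B)) :=
  Submodule.span (UniversalEnvelopingAlgebra ℂ (Heis J B))
    ({UniversalEnvelopingAlgebra.ι ℂ (heisOne B) - 1} ∪
     {x | ∃ i : J, ∃ r : ℤ, 0 ≤ r ∧
        x = UniversalEnvelopingAlgebra.ι ℂ (heisB B i r) -
              algebraMap ℂ (UniversalEnvelopingAlgebra ℂ (Heis J B)) (Λ i r)})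

/-- The induced module `π(Λ) = U(H) / U(H)·(𝟙 − 1, b(i,r) − Λ(i,r) : r ≥ 0)`,
a left `U(H)`-module. -/
abbrev HeisMod (B : SymForm J) (Λ : J → ℤ → ℂ) : Type :=
  UniversalEnvelopingAlgebra ℂ (Heis J B) ⧸ heisIdeal B Λ

/-- The vacuum vector `v_n ∈ π(Λ)`, the image of `1 ∈ U(H)`. -/
def heisVac (B : SymForm J) (Λ : J → ℤ → ℂ) : HeisMod B Λ :=
  Submodule.Quotient.mk 1

/-- The commutator of `b(i,r)` with multiplication by a variable, extended to a derivation. -/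
def fockDerivation (B : SymForm J) (p : J × ℤ) :
    Derivation ℂ (MvPolynomial (J × ℤ) ℂ) (MvPolynomial (J × ℤ) ℂ) :=
  MvPolynomial.mkDerivation ℂ fun q => MvPolynomial.C (heisCoef B p q)

/-- The action of `b(i,r)` on the Fock space: a creation operator if `r < 0`, and an
annihilation operator shifted by `Λ(i,r)` if `r ≥ 0`. -/
def fockOperator (B : SymForm J) (Λ : J → ℤ → ℂ) (p : J × ℤ) :
    Module.End ℂ (MvPolynomial (J × ℤ) ℂ) :=
  if p.2 < 0 then LinearMap.mulLeft ℂ (MvPolynomial.X p)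
  else (fockDerivation B p : Module.End ℂ (MvPolynomial (J × ℤ) ℂ)) + Λ p.1 p.2 • 1

lemma fockDerivation_commute (B : SymForm J) (p q : J × ℤ) (f : MvPolynomial (J × ℤ) ℂ) :
    fockDerivation B p (fockDerivation B q f) = fockDerivation B q (fockDerivation B p f) := by
  have h : ⁅fockDerivation B p, fockDerivation B q⁆ = 0 :=
    MvPolynomial.derivation_ext fun i => by
      simp [Derivation.commutator_apply, fockDerivation, MvPolynomial.mkDerivation_X,
        MvPolynomial.derivation_C]
  simpa [Derivation.commutator_apply, sub_eq_zero] using congrArg (fun D => D f) h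

lemma fockOperator_commutator (B : SymForm J) (Λ : J → ℤ → ℂ) (p q : J × ℤ) :
    fockOperator B Λ p * fockOperator B Λ q - fockOperator B Λ q * fockOperator B Λ p =
      heisCoef B p q • (1 : Module.End ℂ (MvPolynomial (J × ℤ) ℂ)) := by
  have mixed : ∀ p q : J × ℤ, ¬ p.2 < 0 → q.2 < 0 →
      fockOperator B Λ p * fockOperator B Λ q - fockOperator B Λ q * fockOperator B Λ p =
        heisCoef B p q • (1 : Module.End ℂ (MvPolynomial (J × ℤ) ℂ)) := by
    intro p q hp hq
    refine LinearMap.ext fun f => ?_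
    simp only [fockOperator, hp, hq, if_true, if_false, LinearMap.sub_apply, Module.End.mul_apply,
      LinearMap.add_apply, LinearMap.smul_apply, Module.End.one_apply, LinearMap.mulLeft_apply,
      Derivation.coeFn_coe, Derivation.leibniz, smul_eq_mul]
    simp only [fockDerivation, MvPolynomial.mkDerivation_X, MvPolynomial.smul_eq_C_mul]
    ring
  by_cases hp : p.2 < 0 <;> by_cases hq : q.2 < 0
  · have h : heisCoef B p q = 0 := if_neg (by omega)
    refine LinearMap.ext fun f => ?_
    simp [fockOperator, hp, hq, h, mul_left_comm]
  · rw [heisCoef_skew, ← neg_sub, mixed q p hq hp]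
    exact (neg_smul _ _).symm
  · exact mixed p q hp hq
  · have h : heisCoef B p q = 0 := by
      unfold heisCoef
      split_ifs with hpq
      · have : p.2 = 0 := by omega
        simp [this]
      · rfl
    refine LinearMap.ext fun f => ?_
    simp only [fockOperator, hp, hq, if_false, LinearMap.sub_apply, Module.End.mul_apply,
      LinearMap.add_apply, LinearMap.smul_apply, Module.End.one_apply, Derivation.coeFn_coe,
      map_add, fockDerivation_commute B p q, h, zero_smul, LinearMap.zero_apply,
      MvPolynomial.smul_eq_C_mul, Derivation.leibniz, MvPolynomial.derivation_C, smul_eq_mul]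
    ring

/-- The Fock representation of the Heisenberg Lie algebra, as a linear map. -/
def fockLinear (B : SymForm J) (Λ : J → ℤ → ℂ) :
    Heis J B →ₗ[ℂ] Module.End ℂ (MvPolynomial (J × ℤ) ℂ) :=
  LinearMap.coprod (Finsupp.linearCombination ℂ (fockOperator B Λ))
    (LinearMap.toSpanSingleton ℂ _ 1)

lemma fockLinear_apply (B : SymForm J) (Λ : J → ℤ → ℂ) (x : Heis J B) :
    fockLinear B Λ x = Finsupp.linearCombination ℂ (fockOperator B Λ) x.1 + x.2 • 1 := rfl

lemma linearCombination_fockOperator_commutator (B : SymForm J) (Λ : J → ℤ → ℂ)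
    (f g : (J × ℤ) →₀ ℂ) :
    Finsupp.linearCombination ℂ (fockOperator B Λ) f *
          Finsupp.linearCombination ℂ (fockOperator B Λ) g -
        Finsupp.linearCombination ℂ (fockOperator B Λ) g *
          Finsupp.linearCombination ℂ (fockOperator B Λ) f =
      (f.sum fun p c => g.sum fun q d => c * d * heisCoef B p q) •
        (1 : Module.End ℂ (MvPolynomial (J × ℤ) ℂ)) := by
  simp only [Finsupp.linearCombination_apply, Finsupp.sum]
  rw [Finset.sum_mul_sum, Finset.sum_mul_sum, Finset.sum_comm (s := g.support),
    ← Finset.sum_sub_distrib, Finset.sum_smul]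
  refine Finset.sum_congr rfl fun p _ => ?_
  rw [← Finset.sum_sub_distrib, Finset.sum_smul]
  refine Finset.sum_congr rfl fun q _ => ?_
  rw [mul_smul, ← fockOperator_commutator B Λ, smul_sub, smul_mul_smul_comm, smul_mul_smul_comm,
    mul_comm (g q)]

section FockRepresentation

attribute [local instance] LieRing.ofAssociativeRing

/-- The Fock representation of the Heisenberg Lie algebra with vacuum character `Λ`. -/
def fockRep (B : SymForm J) (Λ : J → ℤ → ℂ) :
    Heis J B →ₗ⁅ℂ⁆ Module.End ℂ (MvPolynomial (J × ℤ) ℂ) where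
  __ := fockLinear B Λ
  map_lie' {x y} := by
    change fockLinear B Λ ⁅x, y⁆ = ⁅fockLinear B Λ x, fockLinear B Λ y⁆
    rw [LieRing.of_associative_ring_bracket, fockLinear_apply, fockLinear_apply, fockLinear_apply,
      heis_bracket_fst, heis_bracket_snd, map_zero, zero_add,
      ← linearCombination_fockOperator_commutator B Λ]
    simp only [add_mul, mul_add, smul_mul_assoc, mul_smul_comm, one_mul, mul_one]
    module

lemma fockRep_heisOne (B : SymForm J) (Λ : J → ℤ → ℂ) : fockRep B Λ (heisOne B) = 1 := by
  change fockLinear B Λ (heisOne B) = 1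
  rw [fockLinear_apply]
  simp [heisOne]

lemma fockRep_heisB_vacuum (B : SymForm J) (Λ : J → ℤ → ℂ) (i : J) {r : ℤ} (hr : 0 ≤ r) :
    fockRep B Λ (heisB B i r) 1 = Λ i r • 1 := by
  change fockLinear B Λ (heisB B i r) 1 = Λ i r • 1
  rw [fockLinear_apply]
  simp [heisB, fockOperator, hr.not_gt]

lemma lift_fockRep_vacuum_eq_zero (B : SymForm J) (Λ : J → ℤ → ℂ)
    {x : UniversalEnvelopingAlgebra ℂ (Heis J B)} (hx : x ∈ heisIdeal B Λ) :
    UniversalEnvelopingAlgebra.lift ℂ (fockRep B Λ) x 1 = 0 := by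
  induction hx using Submodule.span_induction with
  | mem x hx =>
    rcases hx with rfl | ⟨i, r, hr, rfl⟩
    · simp [fockRep_heisOne]
    · simp [fockRep_heisB_vacuum B Λ i hr, Algebra.smul_def]
  | zero => simp
  | add x y _ _ hx hy => simp [hx, hy]
  | smul a x _ hx => simp [hx]

lemma one_notMem_heisIdeal (B : SymForm J) (Λ : J → ℤ → ℂ) :
    (1 : UniversalEnvelopingAlgebra ℂ (Heis J B)) ∉ heisIdeal B Λ := fun h =>
  one_ne_zero (α := MvPolynomial (J × ℤ) ℂ) (by simpa using lift_fockRep_vacuum_eq_zero B Λ h)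

end FockRepresentation

/-!
STATEMENT 9: given `n ≥ 1` and a character `Λ` with `Λ(i,r) = 0` for `r ≥ n`, the
vacuum vector `v_n` is nonzero in `π(Λ)`; equivalently, the left ideal of `U(H)`
generated by `𝟙 − 1` and the elements `b(i,r) − Λ(i,r)·1` for `i ∈ J`, `r ≥ 0` is a
proper left ideal.
-/
theorem heisVac_ne_zero (n : ℕ) (hn : 1 ≤ n) (J : Type) (B : SymForm J)
    (Λ : J → ℤ → ℂ) (hΛ : ∀ (i : J) (r : ℤ), (n : ℤ) ≤ r → Λ i r = 0) :
    heisVac B Λ ≠ 0 ∧ heisIdeal B Λ ≠ ⊤ := by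
  exact ⟨fun h => one_notMem_heisIdeal B Λ ((Submodule.Quotient.mk_eq_zero _).mp h),
    fun h => one_notMem_heisIdeal B Λ (h ▸ Submodule.mem_top)⟩

end
end
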